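/- arXiv:1603.00684 — 2 statements merged into one kernel-verified Lean document; each statement's English description precedes it below -/
import Mathlib

section
/- For every real L ≥ 1 and every δ with 0 < δ < 1 there exists N₀ such that for every prime N ≥ N₀ the following holds with Q = ⌊L·log N⌋. Every subset A ⊆ ℤ/Nℤ with |A| ≥ 2·log N satisfies at least one of the following three possibilities: (1) |(A ∔ A) ∩ [1, Q]| ≤ δ·|A ∔ A|; (2) there exists A' ⊆ A with |A'| ≥ (1−δ)·|A| and (A' ∔ A') ∩ [1, Q] = ∅; (3) there exist sets C, D ⊆ A, each contained in an interval of ⌈log N⌉ consecutive residues in ℤ/Nℤ, such that |C| ≥ (δ⁵/(6L⁴))·log N, |D| ≥ (δ⁵/(6L⁴))·log N, and C + D ⊆ [−Q, 2Q]. -/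
open Finset Pointwise

/-- The restricted sumset `X ∔ Y = {x + y : x ∈ X, y ∈ Y, x ≠ y}`. -/
def rsum {α : Type*} [DecidableEq α] [Add α] (A B : Finset α) : Finset α :=
  ((A ×ˢ B).filter fun p => p.1 ≠ p.2).image fun p => p.1 + p.2

theorem mem_rsum {α : Type*} [DecidableEq α] [Add α] {A B : Finset α} {z : α} :
    z ∈ rsum A B ↔ ∃ x ∈ A, ∃ y ∈ B, x ≠ y ∧ x + y = z := by
  simp only [rsum, mem_image, mem_filter, mem_product, Prod.exists]
  constructor
  · rintro ⟨x, y, ⟨⟨hx, hy⟩, hne⟩, rfl⟩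
    exact ⟨x, hx, y, hy, hne, rfl⟩
  · rintro ⟨x, hx, y, hy, hne, rfl⟩
    exact ⟨x, y, ⟨⟨hx, hy⟩, hne⟩, rfl⟩

theorem rsum_subset_add {α : Type*} [DecidableEq α] [Add α] (A B : Finset α) :
    rsum A B ⊆ A + B := by
  intro z hz
  obtain ⟨x, hx, y, hy, -, rfl⟩ := mem_rsum.1 hz
  exact add_mem_add hx hy

theorem card_add_self_le_card_rsum_add_card {α : Type*} [DecidableEq α] [Add α] (A : Finset α) :
    #(A + A) ≤ #(rsum A A) + #A := by
  have h : A + A ⊆ rsum A A ∪ A.image fun x => x + x := by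
    intro z hz
    obtain ⟨x, hx, y, hy, rfl⟩ := mem_add.1 hz
    by_cases hxy : x = y
    · subst hxy
      exact mem_union_right _ (mem_image_of_mem _ hx)
    · exact mem_union_left _ (mem_rsum.2 ⟨x, hx, y, hy, hxy, rfl⟩)
  exact (card_le_card h).trans ((card_union_le _ _).trans (Nat.add_le_add_left card_image_le _))

theorem card_le_card_rsum_self_add_one {α : Type*} [DecidableEq α] [Add α] [IsLeftCancelAdd α]
    (A : Finset α) : #A ≤ #(rsum A A) + 1 := by
  obtain rfl | ⟨a, ha⟩ := A.eq_empty_or_nonempty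
  · simp
  have h : (A.erase a).image (a + ·) ⊆ rsum A A := by
    intro z hz
    obtain ⟨x, hx, rfl⟩ := mem_image.1 hz
    exact mem_rsum.2 ⟨a, ha, x, mem_of_mem_erase hx, (ne_of_mem_erase hx).symm, rfl⟩
  have h₁ := card_le_card h
  rw [card_image_of_injective _ (add_right_injective a), card_erase_of_mem ha] at h₁
  omega

/-- Covering by `O(K³)` translates of `S - S` for `S ⊆ A + A`. -/
theorem exists_cover_of_subset_add_self {G : Type*} [AddCommGroup G] [DecidableEq G]
    {A S : Finset G} (hA : A.Nonempty) (hS : S.Nonempty) (hSA : S ⊆ A + A) :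
    ∃ X ⊆ A, (#X : ℝ) * #S * #A ^ 2 ≤ (#(A + A) : ℝ) ^ 3 ∧ A ⊆ X + (S - S) := by
  have hS₀ : (0 : ℝ) < #S := by exact_mod_cast hS.card_pos
  have hA₀ : (0 : ℝ) < #A := by exact_mod_cast hA.card_pos
  obtain ⟨X, hXA, hX, hcov⟩ := ruzsa_covering_add (A := A) (B := S) (K := #(A + S) / #S) hS
    (by rw [div_mul_cancel₀ _ hS₀.ne'])
  refine ⟨X, hXA, ?_, hcov⟩
  rw [le_div_iff₀ hS₀] at hX
  have h₁ : #(A + S) ≤ #(3 • A) := by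
    rw [show 3 • A = A + (A + A) by abel]
    exact card_le_card (add_subset_add_left hSA)
  have h₂ := pluennecke_ruzsa_inequality_nsmul_add hA A 3
  have h₃ : (#(3 • A) : ℝ) ≤ (#(A + A) / #A : ℝ) ^ 3 * #A := by
    have := (NNRat.cast_le (K := ℝ)).2 h₂
    push_cast at this
    exact this
  have h₄ : (#X : ℝ) * #S ≤ (#(A + A) / #A : ℝ) ^ 3 * #A :=
    hX.trans ((Nat.cast_le.2 h₁).trans h₃)
  calc (#X : ℝ) * #S * #A ^ 2 ≤ (#(A + A) / #A : ℝ) ^ 3 * #A * #A ^ 2 := by gcongr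
    _ = (#(A + A) : ℝ) ^ 3 := by field_simp

/-- Points within distance `< Q` of `X` lie in few intervals of length `M`. -/
theorem exists_interval_of_mem_add_sub {N Q M : ℕ} (hM : 0 < M) {X S : Finset (ZMod N)}
    (hS : S ⊆ (Icc 1 Q).image (Nat.cast : ℕ → ZMod N)) {a : ZMod N} (ha : a ∈ X + (S - S)) :
    ∃ p ∈ X ×ˢ range ((2 * Q - 2) / M + 1), ∃ i < M,
      a = p.1 - ((Q : ZMod N) - 1) + ((p.2 * M : ℕ) : ZMod N) + (i : ZMod N) := by
  obtain ⟨x, hx, t, ht, rfl⟩ := mem_add.1 ha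
  obtain ⟨s, hs, s', hs', rfl⟩ := mem_sub.1 ht
  obtain ⟨u, hu, rfl⟩ := mem_image.1 (hS hs)
  obtain ⟨v, hv, rfl⟩ := mem_image.1 (hS hs')
  rw [mem_Icc] at hu hv
  set w := u + Q - 1 - v with hw
  refine ⟨(x, w / M), ?_, w % M, Nat.mod_lt _ hM, ?_⟩
  · simp only [mem_product, mem_range, hx, true_and]
    exact Nat.lt_succ_of_le (Nat.div_le_div_right (by omega))
  · have h₁ : ((w / M * M : ℕ) : ZMod N) + ((w % M : ℕ) : ZMod N) = (w : ZMod N) := by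
      rw [← Nat.cast_add, Nat.div_add_mod']
    have h₂ : (w : ZMod N) + v + 1 = u + Q := by
      have : w + v + 1 = u + Q := by omega
      exact_mod_cast congrArg (Nat.cast : ℕ → ZMod N) this
    simp only
    linear_combination -h₁ - h₂

/-- If `C` and `D` lie in intervals of length `M` and some sum lies in `[1, Q]`, then all sums
lie in `[-Q, 2Q]`, provided that `2 (M - 1) ≤ Q`. -/
theorem add_subset_of_interval {N Q M : ℕ} (hMQ : 2 * M ≤ Q + 2) {C D : Finset (ZMod N)}
    {b b' x y : ZMod N}
    (hC : ∀ c ∈ C, ∃ i < M, c = b + ((i : ℕ) : ZMod N))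
    (hD : ∀ d ∈ D, ∃ i < M, d = b' + ((i : ℕ) : ZMod N))
    (hx : x ∈ C) (hy : y ∈ D) (hxy : x + y ∈ (Icc 1 Q).image (Nat.cast : ℕ → ZMod N)) :
    C + D ⊆ (Icc (-(Q : ℤ)) (2 * Q)).image (Int.cast : ℤ → ZMod N) := by
  intro z hz
  obtain ⟨c, hc, d, hd, rfl⟩ := mem_add.1 hz
  obtain ⟨i, hi, rfl⟩ := hC c hc
  obtain ⟨j, hj, rfl⟩ := hD d hd
  obtain ⟨i', hi', rfl⟩ := hC x hx
  obtain ⟨j', hj', rfl⟩ := hD y hy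
  obtain ⟨q, hq, hqe⟩ := mem_image.1 hxy
  rw [mem_Icc] at hq
  refine mem_image.2 ⟨(q : ℤ) + i + j - i' - j', ?_, ?_⟩
  · rw [mem_Icc]
    omega
  · push_cast
    linear_combination hqe

/-- Removing from `A` all fibres of `f` of size `< η` costs at most `η` per value of `f`. -/
theorem card_filter_small_fiber_le {α β : Type*} [DecidableEq β] (A : Finset α) (T : Finset β)
    (f : α → β) (hf : ∀ a ∈ A, f a ∈ T) {η : ℝ} (hη : 0 ≤ η) :
    (#{a ∈ A | (#{x ∈ A | f x = f a} : ℝ) < η} : ℝ) ≤ #T * η := by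
  rw [card_eq_sum_card_fiberwise (f := f) (t := T) fun a ha => hf a (mem_filter.1 ha).1,
    Nat.cast_sum, ← nsmul_eq_mul]
  refine sum_le_card_nsmul _ _ _ fun b _ => ?_
  obtain h | ⟨a, ha⟩ := Finset.eq_empty_or_nonempty
    {a ∈ {a ∈ A | (#{x ∈ A | f x = f a} : ℝ) < η} | f a = b}
  · simpa [h] using hη
  · simp only [mem_filter] at ha
    obtain ⟨⟨_, h₁⟩, rfl⟩ := ha
    refine le_trans ?_ h₁.le
    gcongr
    exact filter_subset _ _

theorem numeric_bound {L δ l n R s x J : ℝ} (hL : 1 ≤ L) (hδ0 : 0 < δ) (hδ1 : δ < 1)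
    (hl : 20 ≤ l) (hn : 2 * l ≤ n) (hR : n ≤ R + 1) (hs : δ * R < s) (hsQ : s ≤ L * l)
    (hx0 : 0 ≤ x) (hx : x * s * n ^ 2 ≤ (R + n) ^ 3) (hJ : J ≤ 4 * L + 1) :
    x * J * (δ ^ 5 / (6 * L ^ 4) * l) ≤ δ * n := by
  have hn0 : 0 < n := by linarith
  have hl0 : 0 < l := by linarith
  have hR0 : 0 < R := by linarith
  have hL0 : 0 < L := by linarith
  have h₁ : (R + n) ^ 3 ≤ (48 / 5) * R ^ 3 := by
    calc (R + n) ^ 3 ≤ (2.1 * R) ^ 3 := by gcongr; linarith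
      _ = 2.1 ^ 3 * R ^ 3 := by ring
      _ ≤ _ := by gcongr; norm_num
  have h₂ : x * δ * n ^ 2 ≤ (48 / 5) * R ^ 2 := by
    have : (x * δ * n ^ 2) * R ≤ ((48 / 5) * R ^ 2) * R := by
      calc (x * δ * n ^ 2) * R = x * (δ * R) * n ^ 2 := by ring
        _ ≤ x * s * n ^ 2 := by gcongr
        _ ≤ _ := by linarith
    exact le_of_mul_le_mul_right this hR0
  have h₃ : x * δ ^ 3 * n ^ 2 ≤ (48 / 5) * (L * l) ^ 2 := by
    calc x * δ ^ 3 * n ^ 2 = δ ^ 2 * (x * δ * n ^ 2) := by ring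
      _ ≤ δ ^ 2 * ((48 / 5) * R ^ 2) := by gcongr
      _ = (48 / 5) * (δ * R) ^ 2 := by ring
      _ ≤ (48 / 5) * (L * l) ^ 2 := by
        have : δ * R ≤ L * l := hs.le.trans hsQ
        have := pow_le_pow_left₀ (by positivity) this 2
        linarith
  have h₄ : x * δ ^ 3 ≤ (12 / 5) * L ^ 2 := by
    have : (x * δ ^ 3) * (2 * l) ^ 2 ≤ ((12 / 5) * L ^ 2) * (2 * l) ^ 2 := by
      calc (x * δ ^ 3) * (2 * l) ^ 2 ≤ x * δ ^ 3 * n ^ 2 := by gcongr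
        _ ≤ _ := h₃
        _ = _ := by ring
    exact le_of_mul_le_mul_right this (by positivity)
  calc x * J * (δ ^ 5 / (6 * L ^ 4) * l) ≤ x * (5 * L) * (δ ^ 5 / (6 * L ^ 4) * l) := by
        gcongr; linarith
    _ = (x * δ ^ 3) * (5 * δ ^ 2 * l / (6 * L ^ 3)) := by field_simp
    _ ≤ ((12 / 5) * L ^ 2) * (5 * δ ^ 2 * l / (6 * L ^ 3)) := by gcongr
    _ = δ * (δ * (2 * l) / L) := by field_simp; norm_num
    _ ≤ δ * n := by
        gcongr
        rw [div_le_iff₀ hL0]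
        calc δ * (2 * l) ≤ 1 * n := by gcongr
          _ ≤ n * L := by nlinarith

/-- Trichotomy: for `L ≥ 1`, `0 < δ < 1`, every sufficiently large prime `N`, and
`Q = ⌊L log N⌋`, every `A ⊆ ℤ/Nℤ` with `|A| ≥ 2 log N` is of type 1, 2 or 3. -/
theorem statement4 (L : ℝ) (hL : 1 ≤ L) (δ : ℝ) (hδ0 : 0 < δ) (hδ1 : δ < 1) :
    ∃ N₀ : ℕ, ∀ N : ℕ, N.Prime → N₀ ≤ N →
      ∀ Q : ℕ, Q = ⌊L * Real.logb 2 N⌋₊ →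
        ∀ A : Finset (ZMod N), 2 * Real.logb 2 N ≤ (A.card : ℝ) →
          -- type 1
          (((rsum A A ∩ (Finset.Icc 1 Q).image (Nat.cast : ℕ → ZMod N)).card : ℝ) ≤
              δ * ((rsum A A).card : ℝ)) ∨
          -- type 2
          (∃ A' : Finset (ZMod N), A' ⊆ A ∧ (1 - δ) * (A.card : ℝ) ≤ (A'.card : ℝ) ∧
              rsum A' A' ∩ (Finset.Icc 1 Q).image (Nat.cast : ℕ → ZMod N) = ∅) ∨
          -- type 3
          (∃ C D : Finset (ZMod N), C ⊆ A ∧ D ⊆ A ∧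
              (∃ a : ZMod N,
                C ⊆ (Finset.range ⌈Real.logb 2 N⌉₊).image fun i : ℕ => a + (i : ZMod N)) ∧
              (∃ a : ZMod N,
                D ⊆ (Finset.range ⌈Real.logb 2 N⌉₊).image fun i : ℕ => a + (i : ZMod N)) ∧
              δ ^ 5 / (6 * L ^ 4) * Real.logb 2 N ≤ (C.card : ℝ) ∧
              δ ^ 5 / (6 * L ^ 4) * Real.logb 2 N ≤ (D.card : ℝ) ∧
              C + D ⊆ (Finset.Icc (-(Q : ℤ)) (2 * Q)).image (Int.cast : ℤ → ZMod N)) := by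
  refine ⟨2 ^ 20, fun N hN hN₀ Q hQ A hA => ?_⟩
  have : Fact N.Prime := ⟨hN⟩
  set l := Real.logb 2 N with hl_def
  have hl : 20 ≤ l := by
    rw [hl_def, Real.le_logb_iff_rpow_le one_lt_two (by exact_mod_cast hN.pos)]
    exact_mod_cast hN₀
  have hQL : (Q : ℝ) ≤ L * l := hQ ▸ Nat.floor_le (by positivity)
  set M := ⌊l⌋₊ / 2 + 1 with hM_def
  have hM0 : 0 < M := by omega
  have hlQ : ⌊l⌋₊ ≤ Q := hQ ▸ Nat.floor_mono (le_mul_of_one_le_left (by linarith) hL)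
  have hl_floor : 20 ≤ ⌊l⌋₊ := Nat.le_floor (by exact_mod_cast hl)
  have hMl : M ≤ ⌈l⌉₊ := by
    have := Nat.floor_le_ceil l
    omega
  have hM2 : l < 2 * M := by
    have h₁ := Nat.lt_floor_add_one l
    have h₂ : (⌊l⌋₊ + 1 : ℝ) ≤ 2 * M := by
      have : ⌊l⌋₊ + 1 ≤ 2 * M := by omega
      exact_mod_cast this
    linarith
  set I := (Icc 1 Q).image (Nat.cast : ℕ → ZMod N)
  set S := rsum A A ∩ I
  rw [or_iff_not_imp_left]
  intro hS
  rw [not_le] at hS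
  have hA0 : A.Nonempty := by
    rw [← card_pos]
    have : (0 : ℝ) < #A := by linarith
    exact_mod_cast this
  have hS0 : S.Nonempty := by
    rw [← card_pos]
    have : (0 : ℝ) < #S := lt_of_le_of_lt (by positivity) hS
    exact_mod_cast this
  obtain ⟨X, -, hX, hcov⟩ := exists_cover_of_subset_add_self hA0 hS0
    (inter_subset_left.trans (rsum_subset_add A A))
  set T := X ×ˢ range ((2 * Q - 2) / M + 1) with hT
  have hfib : ∀ a : ZMod N, ∃ p : ZMod N × ℕ, a ∈ A → p ∈ T ∧ ∃ i < M,
      a = p.1 - ((Q : ZMod N) - 1) + ((p.2 * M : ℕ) : ZMod N) + (i : ZMod N) := by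
    intro a
    by_cases ha : a ∈ A
    · obtain ⟨p, hp, hi⟩ := exists_interval_of_mem_add_sub hM0 inter_subset_right (hcov ha)
      exact ⟨p, fun _ => ⟨hp, hi⟩⟩
    · exact ⟨(0, 0), fun h => absurd h ha⟩
  choose f hf using hfib
  set η := δ ^ 5 / (6 * L ^ 4) * l
  have hη0 : 0 ≤ η := by positivity
  have hfiber (b : ZMod N × ℕ) : ∀ c ∈ A.filter (f · = b), ∃ i < M,
      c = b.1 - ((Q : ZMod N) - 1) + ((b.2 * M : ℕ) : ZMod N) + (i : ZMod N) := by
    intro c hc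
    obtain ⟨hcA, rfl⟩ := mem_filter.1 hc
    exact (hf c hcA).2
  have hinterval (b : ZMod N × ℕ) : ∃ a : ZMod N,
      A.filter (f · = b) ⊆ (range ⌈l⌉₊).image fun i : ℕ => a + (i : ZMod N) := by
    refine ⟨b.1 - ((Q : ZMod N) - 1) + ((b.2 * M : ℕ) : ZMod N), fun c hc => ?_⟩
    obtain ⟨i, hi, rfl⟩ := hfiber b c hc
    exact mem_image.2 ⟨i, mem_range.2 (hi.trans_le hMl), rfl⟩
  set A' := A.filter fun a => ¬ (#{x ∈ A | f x = f a} : ℝ) < η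
  by_cases hind : rsum A' A' ∩ I = ∅
  · refine Or.inl ⟨A', filter_subset _ _, ?_, hind⟩
    have h₁ := card_filter_small_fiber_le A T f (fun a ha => (hf a ha).1) hη0
    have h₂ : (#{a ∈ A | (#{x ∈ A | f x = f a} : ℝ) < η} : ℝ) + #A' = #A := by
      exact_mod_cast card_filter_add_card_filter_not (s := A)
        (fun a => (#{x ∈ A | f x = f a} : ℝ) < η)
    have h₃ : (#T : ℝ) * η ≤ δ * #A := by
      rw [hT, card_product, card_range, Nat.cast_mul]
      refine numeric_bound (R := #(rsum A A)) (s := #S) hL hδ0 hδ1 hl hA ?_ hS ?_ (by positivity)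
        (hX.trans ?_) ?_
      · exact_mod_cast card_le_card_rsum_self_add_one A
      · refine le_trans ?_ hQL
        have : #S ≤ Q := (card_le_card inter_subset_right).trans
          (card_image_le.trans (by simp))
        exact_mod_cast this
      · gcongr
        exact_mod_cast card_add_self_le_card_rsum_add_card A
      · have h₄ : (((2 * Q - 2) / M : ℕ) : ℝ) ≤ 4 * L := by
          refine Nat.cast_div_le.trans ?_
          rw [div_le_iff₀ (by positivity)]
          have h₅ : ((2 * Q - 2 : ℕ) : ℝ) ≤ 2 * Q := by
            exact_mod_cast Nat.sub_le _ _
          nlinarith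
        push_cast
        linarith
    linarith
  · right
    obtain ⟨z, hz⟩ := nonempty_iff_ne_empty.2 hind
    obtain ⟨hz, hzI⟩ := mem_inter.1 hz
    obtain ⟨x, hx, y, hy, -, rfl⟩ := mem_rsum.1 hz
    obtain ⟨hxA, hxη⟩ := mem_filter.1 hx
    obtain ⟨hyA, hyη⟩ := mem_filter.1 hy
    exact ⟨A.filter (f · = f x), A.filter (f · = f y), filter_subset _ _, filter_subset _ _,
      hinterval _, hinterval _, not_lt.1 hxη, not_lt.1 hyη,
      add_subset_of_interval (by omega) (hfiber _) (hfiber _)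
        (mem_filter.2 ⟨hxA, rfl⟩) (mem_filter.2 ⟨hyA, rfl⟩) hzI⟩
end

section
/- For every η > 0 there exists a constant C such that for every integer Q ≥ 1, the number of quadruples (n₁, n₂, n₃, n₄) of integers with 1 ≤ nᵢ ≤ Q for i = 1,2,3,4 such that the product n₁·n₂·n₃·n₄ is a perfect square is at most C·Q^{2+η}. -/
/-- The divisor bound: the number of divisors of `n` is `O(n ^ ε)` for every `ε > 0`. -/
lemma exists_card_divisors_le_mul_rpow {ε : ℝ} (hε : 0 < ε) :
    ∃ C : ℝ, 0 < C ∧ ∀ n : ℕ, n ≠ 0 → (n.divisors.card : ℝ) ≤ C * (n : ℝ) ^ ε := by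
  have hc : 0 < ε * Real.log 2 := mul_pos hε (Real.log_pos one_lt_two)
  set M : ℝ := 1 + 1 / (ε * Real.log 2) with hM
  have hM1 : 1 ≤ M := le_add_of_nonneg_right (by positivity)
  set P : ℕ := ⌈(2 : ℝ) ^ (1 / ε)⌉₊
  have hpow (p k : ℕ) : ((p : ℝ) ^ ε) ^ k = ((p ^ k : ℕ) : ℝ) ^ ε := by
    rw [← Real.rpow_natCast, ← Real.rpow_mul (by positivity), mul_comm,
      Real.rpow_mul (by positivity)]
    simp
  have hbern (k : ℕ) : (k : ℝ) + 1 ≤ 2 ^ k := by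
    exact_mod_cast Nat.lt_two_pow_self (n := k)
  have hlarge (p k : ℕ) (hp : P ≤ p) : (k : ℝ) + 1 ≤ ((p : ℝ) ^ ε) ^ k := by
    refine (hbern k).trans (pow_le_pow_left₀ zero_le_two ?_ k)
    calc (2 : ℝ) = ((2 : ℝ) ^ (1 / ε)) ^ ε := by
          rw [← Real.rpow_mul zero_le_two, one_div_mul_cancel hε.ne', Real.rpow_one]
      _ ≤ (p : ℝ) ^ ε := by
          gcongr
          exact (Nat.le_ceil _).trans (by exact_mod_cast hp)
  have hsmall (p k : ℕ) (hp : 2 ≤ p) : (k : ℝ) + 1 ≤ M * ((p : ℝ) ^ ε) ^ k := by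
    have h2 : 1 + k * (ε * Real.log 2) ≤ ((2 : ℝ) ^ ε) ^ k := by
      rw [Real.rpow_def_of_pos two_pos, ← Real.exp_nat_mul, mul_comm (Real.log 2), add_comm]
      exact Real.add_one_le_exp _
    calc (k : ℝ) + 1 ≤ M * (1 + k * (ε * Real.log 2)) := by
          have : M * (1 + k * (ε * Real.log 2))
              = k + 1 + (1 / (ε * Real.log 2) + k * (ε * Real.log 2)) := by
            rw [hM]; field_simp; ring
          rw [this]
          exact le_add_of_nonneg_right (by positivity)
      _ ≤ M * ((2 : ℝ) ^ ε) ^ k := by gcongr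
      _ ≤ M * ((p : ℝ) ^ ε) ^ k := by
          gcongr
          exact_mod_cast hp
  refine ⟨M ^ P, by positivity, fun n hn => ?_⟩
  have hn' : (n : ℝ) ^ ε = ∏ p ∈ n.primeFactors, ((p : ℝ) ^ ε) ^ n.factorization p := by
    conv_lhs => rw [← Nat.prod_factorization_pow_eq_self hn]
    rw [Finsupp.prod, Nat.cast_prod, ← Real.finsetProd_rpow _ _ (fun _ _ => by positivity)]
    exact Finset.prod_congr rfl fun p _ => (hpow p _).symm
  have hprod : ∏ p ∈ n.primeFactors, (if p < P then M else 1) ≤ M ^ P := by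
    rw [Finset.prod_ite, Finset.prod_const, Finset.prod_const_one, mul_one]
    refine pow_le_pow_right₀ hM1 ?_
    calc _ ≤ (Finset.range P).card := Finset.card_le_card fun p hp => by simp_all
      _ = P := Finset.card_range P
  rw [Nat.card_divisors hn, hn', Nat.cast_prod]
  calc _ ≤ ∏ p ∈ n.primeFactors,
        (if p < P then M else 1) * ((p : ℝ) ^ ε) ^ n.factorization p := by
        refine Finset.prod_le_prod (fun _ _ => by positivity) fun p hp => ?_
        push_cast
        split_ifs with h
        · exact hsmall p _ (Nat.prime_of_mem_primeFactors hp).two_le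
        · rw [one_mul]
          exact hlarge p _ (not_lt.mp h)
    _ ≤ _ := by
        rw [Finset.prod_mul_distrib]
        gcongr

/-- If `a * b` is a square, then `a` and `b` have the same squarefree part. -/
lemma Nat.exists_eq_mul_sq_of_isSquare_mul {a b : ℕ} (ha : 0 < a) (hb : 0 < b)
    (h : IsSquare (a * b)) :
    ∃ d x y : ℕ, 0 < d ∧ 0 < x ∧ 0 < y ∧ a = d * x ^ 2 ∧ b = d * y ^ 2 := by
  obtain ⟨d, x, hd, hx, rfl, hsq⟩ := Nat.sq_mul_squarefree_of_pos ha
  obtain ⟨z, hz⟩ := h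
  have hxz : x ∣ z := by
    rw [← Nat.pow_dvd_pow_iff two_ne_zero, pow_two z, ← hz, mul_assoc]
    exact dvd_mul_right _ _
  obtain ⟨w, rfl⟩ := hxz
  have hw : d * b = w ^ 2 := by
    refine Nat.eq_of_mul_eq_mul_left (pow_pos hx 2) ?_
    linarith
  have hdw : d ∣ w := (hsq.dvd_pow_iff_dvd two_ne_zero).mp (hw ▸ dvd_mul_right d b)
  obtain ⟨y, rfl⟩ := hdw
  have hby : b = d * y ^ 2 := by
    refine Nat.eq_of_mul_eq_mul_left hd ?_
    linarith
  refine ⟨d, x, y, hd, hx, Nat.pos_of_ne_zero ?_, mul_comm _ _, hby⟩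
  rintro rfl
  simp [hby] at hb

/-- Quadruples with square product are covered by data `(d, x, y, n₁, n₃)` with
`n₁ ∣ d * x ^ 2` and `n₃ ∣ d * y ^ 2`. -/
lemma card_quadruples_isSquare_le (Q : ℕ) :
    Nat.card {t : ℕ × ℕ × ℕ × ℕ //
        (1 ≤ t.1 ∧ t.1 ≤ Q) ∧ (1 ≤ t.2.1 ∧ t.2.1 ≤ Q) ∧
        (1 ≤ t.2.2.1 ∧ t.2.2.1 ≤ Q) ∧ (1 ≤ t.2.2.2 ∧ t.2.2.2 ≤ Q) ∧
        IsSquare (t.1 * t.2.1 * t.2.2.1 * t.2.2.2)} ≤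
      ∑ d ∈ Finset.Icc 1 (Q ^ 2),
        (∑ x ∈ Finset.Icc 1 (Nat.sqrt (Q ^ 2 / d)), (d * x ^ 2).divisors.card) ^ 2 := by
  classical
  let U (d : ℕ) := (Finset.Icc 1 (Nat.sqrt (Q ^ 2 / d))).sigma fun x => (d * x ^ 2).divisors
  let V := (Finset.Icc 1 (Q ^ 2)).sigma fun d => U d ×ˢ U d
  let f : (Σ _ : ℕ, (Σ _ : ℕ, ℕ) × (Σ _ : ℕ, ℕ)) → ℕ × ℕ × ℕ × ℕ := fun v =>
    (v.2.1.2, v.1 * v.2.1.1 ^ 2 / v.2.1.2, v.2.2.2, v.1 * v.2.2.1 ^ 2 / v.2.2.2)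
  have hV : V.card = ∑ d ∈ Finset.Icc 1 (Q ^ 2),
      (∑ x ∈ Finset.Icc 1 (Nat.sqrt (Q ^ 2 / d)), (d * x ^ 2).divisors.card) ^ 2 := by
    simp [V, U, Finset.card_sigma, Finset.card_product, pow_two]
  have hU {d x m n : ℕ} (hd : 0 < d) (hx : 0 < x) (hm : m ≤ Q) (hn : n ≤ Q)
      (h : m * n = d * x ^ 2) : (⟨x, m⟩ : Σ _ : ℕ, ℕ) ∈ U d := by
    have hle : d * x ^ 2 ≤ Q ^ 2 := by rw [← h, pow_two Q]; exact Nat.mul_le_mul hm hn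
    simp only [U, Finset.mem_sigma, Finset.mem_Icc, Nat.mem_divisors]
    refine ⟨⟨hx, ?_⟩, h ▸ dvd_mul_right m n, by positivity⟩
    rw [Nat.le_sqrt', Nat.le_div_iff_mul_le hd, mul_comm]
    exact hle
  rw [← hV]
  refine le_trans ?_ (Finset.card_image_le (s := V) (f := f))
  rw [← Set.ncard_coe_finset]
  refine Set.ncard_le_ncard (s := Set.ofPred _) ?_ (Finset.finite_toSet _)
  rintro ⟨n₁, n₂, n₃, n₄⟩ ⟨⟨h₁, h₁'⟩, ⟨h₂, h₂'⟩, ⟨h₃, h₃'⟩, ⟨h₄, h₄'⟩, hsq⟩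
  dsimp only at *
  rw [mul_assoc] at hsq
  obtain ⟨d, x, y, hd, hx, hy, ha, hb⟩ :=
    Nat.exists_eq_mul_sq_of_isSquare_mul (Nat.mul_pos h₁ h₂) (Nat.mul_pos h₃ h₄) hsq
  refine Finset.mem_coe.mpr (Finset.mem_image.mpr ⟨⟨d, ⟨x, n₁⟩, ⟨y, n₃⟩⟩, ?_, ?_⟩)
  · refine Finset.mem_sigma.mpr ⟨Finset.mem_Icc.mpr ⟨hd, ?_⟩,
      Finset.mem_product.mpr ⟨hU hd hx h₁' h₂' ha, hU hd hy h₃' h₄' hb⟩⟩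
    calc d ≤ d * x ^ 2 := Nat.le_mul_of_pos_right d (by positivity)
      _ ≤ Q ^ 2 := by rw [← ha, pow_two Q]; exact Nat.mul_le_mul h₁' h₂'
  · simp only [f, ← ha, ← hb]
    rw [Nat.mul_div_cancel_left _ h₁, Nat.mul_div_cancel_left _ h₃]


/-- For every `η > 0` there is a constant `C` such that for every `Q ≥ 1`, the number of
quadruples `(n₁,n₂,n₃,n₄)` with `1 ≤ nᵢ ≤ Q` whose product is a perfect square is at most
`C Q^(2+η)`. -/
theorem statement9 (η : ℝ) (hη : 0 < η) :
    ∃ C : ℝ, 0 < C ∧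
      ∀ Q : ℕ, 1 ≤ Q →
        (Nat.card {t : ℕ × ℕ × ℕ × ℕ //
            (1 ≤ t.1 ∧ t.1 ≤ Q) ∧ (1 ≤ t.2.1 ∧ t.2.1 ≤ Q) ∧
            (1 ≤ t.2.2.1 ∧ t.2.2.1 ≤ Q) ∧ (1 ≤ t.2.2.2 ∧ t.2.2.2 ≤ Q) ∧
            IsSquare (t.1 * t.2.1 * t.2.2.1 * t.2.2.2)} : ℝ) ≤
          C * (Q : ℝ) ^ ((2 : ℝ) + η) := by
  have hε : 0 < η / 6 := by positivity
  obtain ⟨ε, hε_def⟩ : ∃ ε, ε = η / 6 := ⟨_, rfl⟩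
  rw [← hε_def] at hε
  obtain ⟨C, hC, hdiv⟩ := exists_card_divisors_le_mul_rpow hε
  refine ⟨C ^ 2 * (1 + 1 / ε), by positivity, fun Q hQ => ?_⟩
  refine (Nat.cast_le.mpr (card_quadruples_isSquare_le Q)).trans ?_
  obtain ⟨N, hN⟩ : ∃ N, N = Q ^ 2 := ⟨_, rfl⟩
  have hN1 : (1 : ℝ) ≤ N := by exact_mod_cast hN ▸ Nat.one_le_pow 2 Q hQ
  have hN0 : (0 : ℝ) < N := by linarith
  have hterm (d : ℕ) (hd : d ∈ Finset.Icc 1 N) :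
      (∑ x ∈ Finset.Icc 1 (Nat.sqrt (N / d)), ((d * x ^ 2).divisors.card : ℝ)) ^ 2 ≤
        (C * (N : ℝ) ^ ε) ^ 2 * N * (d : ℝ)⁻¹ := by
    have hd0 : 0 < d := (Finset.mem_Icc.mp hd).1
    have hsum : ∑ x ∈ Finset.Icc 1 (Nat.sqrt (N / d)), ((d * x ^ 2).divisors.card : ℝ) ≤
        Nat.sqrt (N / d) * (C * (N : ℝ) ^ ε) := by
      refine (Finset.sum_le_card_nsmul _ _ (C * (N : ℝ) ^ ε) fun x hx => ?_).trans (by simp)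
      obtain ⟨hx1, hx2⟩ := Finset.mem_Icc.mp hx
      rw [Nat.le_sqrt', Nat.le_div_iff_mul_le hd0, mul_comm] at hx2
      refine (hdiv _ (by positivity)).trans ?_
      gcongr
    have hsqrt : (Nat.sqrt (N / d) : ℝ) ^ 2 ≤ N * (d : ℝ)⁻¹ := by
      rw [← div_eq_mul_inv]
      refine le_trans ?_ (Nat.cast_div_le (m := N) (n := d))
      exact_mod_cast Nat.sqrt_le' (N / d)
    calc _ ≤ (Nat.sqrt (N / d) * (C * (N : ℝ) ^ ε)) ^ 2 := by gcongr
      _ = (C * (N : ℝ) ^ ε) ^ 2 * (Nat.sqrt (N / d) : ℝ) ^ 2 := by ring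
      _ ≤ (C * (N : ℝ) ^ ε) ^ 2 * (N * (d : ℝ)⁻¹) := by gcongr
      _ = _ := by ring
  have hharm : ∑ d ∈ Finset.Icc 1 N, (d : ℝ)⁻¹ ≤ (1 + 1 / ε) * (N : ℝ) ^ ε := by
    have h1 := harmonic_le_one_add_log N
    rw [harmonic_eq_sum_Icc] at h1
    push_cast at h1
    have h2 := Real.log_le_rpow_div hN0.le hε
    have h3 := Real.one_le_rpow hN1 hε.le
    calc _ ≤ 1 + Real.log N := h1
      _ ≤ (N : ℝ) ^ ε + (N : ℝ) ^ ε / ε := by gcongr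
      _ = _ := by ring
  have hpow : ((N : ℝ) ^ ε) ^ 3 * N = (Q : ℝ) ^ (2 + η) := by
    have hQ0 : (0 : ℝ) < Q := by exact_mod_cast hQ
    rw [hN, Nat.cast_pow, ← Real.rpow_natCast (Q : ℝ) 2, ← Real.rpow_mul hQ0.le,
      ← Real.rpow_natCast (_ ^ _) 3, ← Real.rpow_mul hQ0.le, ← Real.rpow_add hQ0]
    congr 1
    rw [hε_def]
    push_cast
    ring
  rw [← hN]
  push_cast
  calc _ ≤ ∑ d ∈ Finset.Icc 1 N, (C * (N : ℝ) ^ ε) ^ 2 * N * (d : ℝ)⁻¹ := Finset.sum_le_sum hterm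
    _ ≤ (C * (N : ℝ) ^ ε) ^ 2 * N * ((1 + 1 / ε) * (N : ℝ) ^ ε) := by
        rw [← Finset.mul_sum]
        gcongr
    _ = C ^ 2 * (1 + 1 / ε) * (((N : ℝ) ^ ε) ^ 3 * N) := by ring
    _ = _ := by rw [hpow]
end
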